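/- Let φ : ℝ⁴ → ℝ be smooth and let R^a_{bcd} be the Riemann curvature tensor of the geometrized Newtonian connection associated with φ. Then the curvature condition CC2 of the Trautman Geometrization Lemma holds: for all x ∈ ℝ⁴ and all indices a,b,c,d, Σ_n h^{cn} R^a_{bnd}(x) = Σ_n h^{an} R^c_{dnb}(x), both sides being equal to t_b t_d ∂^c ∂^a φ(x). -/

import Mathlib

/-- Partial derivative in the `a`-th coordinate direction on `ℝ⁴`. -/
noncomputable def pd (a : Fin 4) (f : (Fin 4 → ℝ) → ℝ) (x : Fin 4 → ℝ) : ℝ :=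
  fderiv ℝ f x (Pi.single a 1)

/-- The temporal covector `t_a`: `t_0 = 1`, `t_1 = t_2 = t_3 = 0`. -/
def tcov (a : Fin 4) : ℝ := if a = 0 then 1 else 0

/-- The spatial metric `h^{ab} = diag(0,1,1,1)`. -/
def hmat (a b : Fin 4) : ℝ := if a = b ∧ a ≠ 0 then 1 else 0

/-- The raised spatial gradient `∂^a φ = Σ_b h^{ab} ∂_b φ`. -/
noncomputable def gradUp (φ : (Fin 4 → ℝ) → ℝ) (a : Fin 4) (x : Fin 4 → ℝ) : ℝ :=
  ∑ b, hmat a b * pd b φ x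

/-- Christoffel symbols `Γ^a_{bc} = t_b t_c ∂^a φ` of the geometrized Newtonian connection. -/
noncomputable def chris (φ : (Fin 4 → ℝ) → ℝ) (a b c : Fin 4) (x : Fin 4 → ℝ) : ℝ :=
  tcov b * tcov c * gradUp φ a x

/-- Riemann curvature tensor
`R^a_{bcd} = ∂_c Γ^a_{db} − ∂_d Γ^a_{cb} + Σ_e (Γ^a_{ce} Γ^e_{db} − Γ^a_{de} Γ^e_{cb})`. -/
noncomputable def riem (φ : (Fin 4 → ℝ) → ℝ) (a b c d : Fin 4) (x : Fin 4 → ℝ) : ℝ :=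
  pd c (chris φ a d b) x - pd d (chris φ a c b) x
    + ∑ e, (chris φ a c e x * chris φ e d b x - chris φ a d e x * chris φ e c b x)

theorem gradUp_eq (φ : (Fin 4 → ℝ) → ℝ) (a : Fin 4) (x : Fin 4 → ℝ) :
    gradUp φ a x = hmat a a * pd a φ x := by
  unfold gradUp
  refine Finset.sum_eq_single a (fun b _ hb => ?_) (by simp)
  simp [hmat, Ne.symm hb]

/-- Constants factor out of partial derivatives, without any differentiability assumption. -/
theorem pd_const_mul (a : Fin 4) (k : ℝ) (f : (Fin 4 → ℝ) → ℝ) (x : Fin 4 → ℝ) :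
    pd a (fun y => k * f y) x = k * pd a f x := by
  have h := fderiv_const_smul_field (𝕜 := ℝ) (f := f) k
  have e : (fun y => k * f y) = k • f := by ext; simp
  simp only [pd, e, h]
  simp

theorem pd_chris (φ : (Fin 4 → ℝ) → ℝ) (n a b c : Fin 4) (x : Fin 4 → ℝ) :
    pd n (chris φ a b c) x = tcov b * tcov c * pd n (gradUp φ a) x :=
  pd_const_mul n (tcov b * tcov c) (gradUp φ a) x

theorem hmat_mul_tcov (c n : Fin 4) : hmat c n * tcov n = 0 := by
  unfold hmat tcov
  split_ifs <;> simp_all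

/-- Partial derivatives of a smooth function commute. -/
theorem pd_comm {φ : (Fin 4 → ℝ) → ℝ} (hφ : ContDiff ℝ (⊤ : ℕ∞) φ) (a c : Fin 4)
    (x : Fin 4 → ℝ) : pd c (pd a φ) x = pd a (pd c φ) x := by
  have hd : DifferentiableAt ℝ (fderiv ℝ φ) x :=
    ((hφ.fderiv_right (m := 1) (by norm_cast)).differentiable one_ne_zero) x
  have key (i j : Fin 4) :
      pd j (pd i φ) x = fderiv ℝ (fderiv ℝ φ) x (Pi.single j 1) (Pi.single i 1) := by
    have h := hd.hasFDerivAt.clm_apply (hasFDerivAt_const (Pi.single i (1 : ℝ)) x)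
    change fderiv ℝ (fun y => fderiv ℝ φ y (Pi.single i 1)) x (Pi.single j 1) = _
    rw [h.fderiv]
    simp
  have hs : IsSymmSndFDerivAt ℝ φ x :=
    hφ.contDiffAt.isSymmSndFDerivAt (by simpa using WithTop.coe_le_coe.mpr (le_top : (2 : ℕ∞) ≤ ⊤))
  rw [key, key]
  exact hs _ _

theorem gradUp_comm {φ : (Fin 4 → ℝ) → ℝ} (hφ : ContDiff ℝ (⊤ : ℕ∞) φ) (a c : Fin 4)
    (x : Fin 4 → ℝ) : gradUp (gradUp φ a) c x = gradUp (gradUp φ c) a x := by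
  have e (i j : Fin 4) :
      gradUp (gradUp φ i) j x = hmat j j * (hmat i i * pd j (pd i φ) x) := by
    rw [gradUp_eq, funext (gradUp_eq φ i), pd_const_mul]
  rw [e, e, pd_comm hφ]
  ring

theorem sum_hmat_mul_riem (φ : (Fin 4 → ℝ) → ℝ) (x : Fin 4 → ℝ) (a b c d : Fin 4) :
    ∑ n, hmat c n * riem φ a b n d x = tcov b * tcov d * gradUp (gradUp φ a) c x := by
  rw [gradUp, Finset.mul_sum]
  refine Finset.sum_congr rfl fun n _ => ?_
  rcases mul_eq_zero.mp (hmat_mul_tcov c n) with h | h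
  · simp [h]
  · simp only [riem, pd_chris]
    simp only [chris, h]
    simp
    ring

/-- Curvature condition CC2 for the geometrized Newtonian connection:
`Σ_n h^{cn} R^a_{bnd} = Σ_n h^{an} R^c_{dnb}`, both sides being `t_b t_d ∂^c ∂^a φ`. -/
theorem stmt_6 (φ : (Fin 4 → ℝ) → ℝ) (hφ : ContDiff ℝ (⊤ : ℕ∞) φ)
    (x : Fin 4 → ℝ) (a b c d : Fin 4) :
    ((∑ n, hmat c n * riem φ a b n d x) = (∑ n, hmat a n * riem φ c d n b x)) ∧
    ((∑ n, hmat c n * riem φ a b n d x) = tcov b * tcov d * gradUp (gradUp φ a) c x) := by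
  refine ⟨?_, sum_hmat_mul_riem φ x a b c d⟩
  rw [sum_hmat_mul_riem, sum_hmat_mul_riem, gradUp_comm hφ]
  ring
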